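/- For every N ≥ 1, as measures on Z^T × Z^{MT} × (Z^T)^N: π(dz) Φ(z, dζ) ∏_{i=1}^N Φ̌(ζ, du^{(i)}) = ψ̄(dζ) Φ̌(ζ, dz) ∏_{i=1}^N Φ̌(ζ, du^{(i)}), where Φ(z, dζ) := Σ_{k∈{1,…,M}^T} Φ(z, d(k,ζ)) and Φ̌(ζ, dz) := Σ_{k∈{1,…,M}^T} Φ̌(ζ, d(k,z)). Consequently, under the joint law π(dz) ∫_ζ Φ(z, dζ) ∏_{i=1}^N Φ̌(ζ, du^{(i)}), the Z^T-valued random variables z, u^{(1)}, …, u^{(N)} are exchangeable. -/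

import Mathlib

open MeasureTheory ProbabilityTheory
open scoped ENNReal

noncomputable section

namespace CSMC

variable {Z : Type*} [MeasurableSpace Z]

/-- Unnormalised target density along a path: `∏_t w_t(z_t) ∏_t f(z_{t-1}, z_t)`. -/
def pathDens {n : ℕ} (f : Z → Z → ℝ) (w : Fin (n + 1) → Z → ℝ)
    (z : Fin (n + 1) → Z) : ℝ≥0∞ :=
  (∏ t : Fin (n + 1), ENNReal.ofReal (w t (z t)))
    * ∏ s : Fin n, ENNReal.ofReal (f (z s.castSucc) (z s.succ))

/-- Base measure on path space: coordinate `0` carries `μ`, the others `λ`. -/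
def pathBase (lam μ : Measure Z) (n : ℕ) : Measure (Fin (n + 1) → Z) :=
  Measure.pi (fun i => if i = 0 then μ else lam)

/-- The target `π(dz) = C⁻¹ ∏_t w_t(z_t) μ(dz₁) ∏_t F(z_{t-1}, dz_t)`. -/
def targetLaw (lam μ : Measure Z) {n : ℕ} (f : Z → Z → ℝ) (w : Fin (n + 1) → Z → ℝ)
    (C : ℝ≥0∞) : Measure (Fin (n + 1) → Z) :=
  (pathBase lam μ n).withDensity (fun z => C⁻¹ * pathDens f w z)

/-- Base measure on particle space: time-`0` particles carry `μ`, the others `λ`. -/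
def particleBase (lam μ : Measure Z) (n M : ℕ) : Measure (Fin (n + 1) → Fin M → Z) :=
  Measure.pi (fun t => Measure.pi (fun _ : Fin M => if t = 0 then μ else lam))

/-- Density of the multinomial-resampling transitions of the bootstrap particle filter. -/
def resampleDens {n M : ℕ} (f : Z → Z → ℝ) (w : Fin (n + 1) → Z → ℝ)
    (ζ : Fin (n + 1) → Fin M → Z) : ℝ≥0∞ :=
  ∏ s : Fin n, ∏ i : Fin M,
    (∑ j : Fin M, ENNReal.ofReal (w s.castSucc (ζ s.castSucc j))
        * ENNReal.ofReal (f (ζ s.castSucc j) (ζ s.succ i)))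
      / ∑ j : Fin M, ENNReal.ofReal (w s.castSucc (ζ s.castSucc j))

/-- The marginal law `ψ` of the particles of the bootstrap particle filter. -/
def smcLaw (lam μ : Measure Z) (M : ℕ) {n : ℕ} (f : Z → Z → ℝ)
    (w : Fin (n + 1) → Z → ℝ) : Measure (Fin (n + 1) → Fin M → Z) :=
  (particleBase lam μ n M).withDensity (resampleDens f w)

/-- The normalising-constant estimator `Ĉ(ζ) = ∏_t M⁻¹ ∑_i w_t(ζ_t^{(i)})`. -/
def Chat (M : ℕ) {n : ℕ} (w : Fin (n + 1) → Z → ℝ)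
    (ζ : Fin (n + 1) → Fin M → Z) : ℝ≥0∞ :=
  ∏ t : Fin (n + 1), (M : ℝ≥0∞)⁻¹ * ∑ i : Fin M, ENNReal.ofReal (w t (ζ t i))

/-- `ψ̄ = ψ.withDensity (Ĉ/C)`. -/
def smcBar (lam μ : Measure Z) (M : ℕ) {n : ℕ} (f : Z → Z → ℝ)
    (w : Fin (n + 1) → Z → ℝ) (C : ℝ≥0∞) : Measure (Fin (n + 1) → Fin M → Z) :=
  (smcLaw lam μ M f w).withDensity (fun ζ => Chat M w ζ / C)

/-- Base measure of the conditional SMC particles given reference path `z` and slots `k`: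
particle `(t, k_t)` is frozen at `z_t`, the others carry `μ` (at `t = 0`) or `λ`. -/
def condBase (lam μ : Measure Z) {n M : ℕ} (z : Fin (n + 1) → Z)
    (k : Fin (n + 1) → Fin M) : Measure (Fin (n + 1) → Fin M → Z) :=
  Measure.pi (fun t => Measure.pi (fun i =>
    if i = k t then Measure.dirac (z t) else if t = 0 then μ else lam))

/-- Density of the conditional SMC transitions (free particles only). -/
def condDens {n M : ℕ} (f : Z → Z → ℝ) (w : Fin (n + 1) → Z → ℝ)
    (k : Fin (n + 1) → Fin M) (ζ : Fin (n + 1) → Fin M → Z) : ℝ≥0∞ :=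
  ∏ s : Fin n, ∏ i : Fin M,
    if i = k s.succ then 1 else
      (∑ j : Fin M, ENNReal.ofReal (w s.castSucc (ζ s.castSucc j))
          * ENNReal.ofReal (f (ζ s.castSucc j) (ζ s.succ i)))
        / ∑ j : Fin M, ENNReal.ofReal (w s.castSucc (ζ s.castSucc j))

/-- The (extended) conditional SMC law `Φ(z, d(k, ζ))`. -/
def csmcLaw (lam μ : Measure Z) (M : ℕ) {n : ℕ} (f : Z → Z → ℝ)
    (w : Fin (n + 1) → Z → ℝ) (z : Fin (n + 1) → Z) :
    Measure ((Fin (n + 1) → Fin M) × (Fin (n + 1) → Fin M → Z)) :=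
  ∑ k : Fin (n + 1) → Fin M, (((M : ℝ≥0∞) ^ (n + 1))⁻¹) •
    (((condBase lam μ z k).withDensity (condDens f w k)).map (fun ζ => (k, ζ)))

/-- The backward-sampling probability `φ(k ∣ ζ)`. -/
def bsProb {n M : ℕ} (f : Z → Z → ℝ) (w : Fin (n + 1) → Z → ℝ)
    (k : Fin (n + 1) → Fin M) (ζ : Fin (n + 1) → Fin M → Z) : ℝ≥0∞ :=
  (ENNReal.ofReal (w (Fin.last n) (ζ (Fin.last n) (k (Fin.last n))))
      / ∑ i : Fin M, ENNReal.ofReal (w (Fin.last n) (ζ (Fin.last n) i)))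
    * ∏ s : Fin n,
      (ENNReal.ofReal (w s.castSucc (ζ s.castSucc (k s.castSucc)))
          * ENNReal.ofReal (f (ζ s.castSucc (k s.castSucc)) (ζ s.succ (k s.succ))))
        / ∑ i : Fin M, ENNReal.ofReal (w s.castSucc (ζ s.castSucc i))
            * ENNReal.ofReal (f (ζ s.castSucc i) (ζ s.succ (k s.succ)))

/-- The backward-sampling law `Φ̌(ζ, d(k, z))`. -/
def bsLaw {M : ℕ} {n : ℕ} (f : Z → Z → ℝ) (w : Fin (n + 1) → Z → ℝ)
    (ζ : Fin (n + 1) → Fin M → Z) :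
    Measure ((Fin (n + 1) → Fin M) × (Fin (n + 1) → Z)) :=
  ∑ k : Fin (n + 1) → Fin M,
    bsProb f w k ζ • Measure.dirac (k, fun t => ζ t (k t))

set_option linter.unusedSectionVars false

lemma sigmaFinite_ite (p : Prop) [Decidable p] (μ ν : Measure Z) [SigmaFinite μ]
    [SigmaFinite ν] : SigmaFinite (if p then μ else ν) := by
  split_ifs <;> infer_instance

/-- The particle system obtained by inserting the path `z` at the slots `k` into `η`. -/
def insertPath {ι : Type*} {m : ℕ} (k : ι → Fin (m + 1)) (z : ι → Z) (η : ι → Fin m → Z) :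
    ι → Fin (m + 1) → Z :=
  fun t => (k t).insertNth (z t) (η t)

lemma insertPath_apply_slot {ι : Type*} {m : ℕ} (k : ι → Fin (m + 1)) (z : ι → Z)
    (η : ι → Fin m → Z) : (fun t => insertPath k z η t (k t)) = z := by
  funext t
  simp [insertPath]

lemma measurable_insertNth_prod {m : ℕ} (k : Fin (m + 1)) :
    Measurable (fun p : Z × (Fin m → Z) => (k.insertNth p.1 p.2 : Fin (m + 1) → Z)) :=
  (MeasurableEquiv.piFinSuccAbove (fun _ : Fin (m + 1) => Z) k).symm.measurable

lemma measurable_insertPath {ι : Type*} {m : ℕ} (k : ι → Fin (m + 1)) :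
    Measurable (fun p : (ι → Z) × (ι → Fin m → Z) => insertPath k p.1 p.2) := by
  refine measurable_pi_lambda _ fun t => ?_
  exact (measurable_insertNth_prod (k t)).comp
    (((measurable_pi_apply t).comp measurable_fst).prodMk
      ((measurable_pi_apply t).comp measurable_snd))

lemma measurePreserving_insertNth {m : ℕ} (ρ : Fin (m + 1) → Measure Z)
    [∀ i, SigmaFinite (ρ i)] (k : Fin (m + 1)) :
    MeasurePreserving (fun p : Z × (Fin m → Z) => (k.insertNth p.1 p.2 : Fin (m + 1) → Z))
      ((ρ k).prod (Measure.pi fun j => ρ (k.succAbove j))) (Measure.pi ρ) :=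
  (measurePreserving_piFinSuccAbove ρ k).symm

lemma pi_ite_dirac {m : ℕ} (ρ : Measure Z) [SigmaFinite ρ] (k : Fin (m + 1)) (z : Z) :
    Measure.pi (fun i => if i = k then Measure.dirac z else ρ)
      = (Measure.pi (fun _ : Fin m => ρ)).map
        (fun η => (k.insertNth z η : Fin (m + 1) → Z)) := by
  have : ∀ i, SigmaFinite (if i = k then Measure.dirac z else ρ) := fun i =>
    sigmaFinite_ite _ _ _
  rw [← (measurePreserving_insertNth (fun i => if i = k then Measure.dirac z else ρ) k).map_eq]
  simp only [if_true, Fin.succAbove_ne, if_false]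
  rw [Measure.dirac_prod, Measure.map_map (measurable_insertNth_prod k) measurable_prodMk_left]
  rfl

lemma pi_pi_ite_dirac {ι : Type*} [Fintype ι] {m : ℕ} (ρ : ι → Measure Z)
    [∀ t, SigmaFinite (ρ t)] (k : ι → Fin (m + 1)) (z : ι → Z) :
    Measure.pi (fun t => Measure.pi (fun i => if i = k t then Measure.dirac (z t) else ρ t))
      = (Measure.pi (fun t => Measure.pi (fun _ : Fin m => ρ t))).map (insertPath k z) := by
  have hm : ∀ t, Measurable (fun η : Fin m → Z =>
      ((k t).insertNth (z t) η : Fin (m + 1) → Z)) := fun t =>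
    (measurable_insertNth_prod (k t)).comp measurable_prodMk_left
  have : ∀ t i, SigmaFinite (if i = k t then Measure.dirac (z t) else ρ t) := fun t i =>
    sigmaFinite_ite _ _ _
  have : ∀ t, SigmaFinite ((Measure.pi (fun _ : Fin m => ρ t)).map
      (fun η => ((k t).insertNth (z t) η : Fin (m + 1) → Z))) := fun t => by
    rw [← pi_ite_dirac]; infer_instance
  simp_rw [pi_ite_dirac]
  exact (Measure.pi_map_pi (fun t => (hm t).aemeasurable)).symm

lemma measurePreserving_insertPath {ι : Type*} [Fintype ι] {m : ℕ} (ρ : ι → Measure Z)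
    [∀ t, SigmaFinite (ρ t)] (k : ι → Fin (m + 1)) :
    MeasurePreserving (fun p : (ι → Z) × (ι → Fin m → Z) => insertPath k p.1 p.2)
      ((Measure.pi ρ).prod (Measure.pi (fun t => Measure.pi (fun _ : Fin m => ρ t))))
      (Measure.pi (fun t => Measure.pi (fun _ : Fin (m + 1) => ρ t))) := by
  have h1 := (measurePreserving_arrowProdEquivProdArrow Z (Fin m → Z) ι ρ
    (fun t => Measure.pi (fun _ : Fin m => ρ t))).symm
  have h2 := measurePreserving_pi _ _
    (fun t => measurePreserving_insertNth (fun _ : Fin (m + 1) => ρ t) (k t))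
  exact h2.comp h1

section Densities

variable {n M : ℕ} {f : Z → Z → ℝ} {w : Fin (n + 1) → Z → ℝ}

lemma measurable_weight (hwm : ∀ t, Measurable (w t)) (t : Fin (n + 1)) (i : Fin M) :
    Measurable (fun ζ : Fin (n + 1) → Fin M → Z => ENNReal.ofReal (w t (ζ t i))) :=
  ((hwm t).comp ((measurable_pi_apply i).comp (measurable_pi_apply t))).ennreal_ofReal

lemma measurable_transition (hfm : Measurable (Function.uncurry f)) (t t' : Fin (n + 1))
    (i i' : Fin M) :
    Measurable (fun ζ : Fin (n + 1) → Fin M → Z => ENNReal.ofReal (f (ζ t i) (ζ t' i'))) :=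
  Measurable.ennreal_ofReal (hfm.comp (g := Function.uncurry f)
    (f := fun ζ : Fin (n + 1) → Fin M → Z => (ζ t i, ζ t' i')) (by fun_prop))

lemma measurable_pathDens (hfm : Measurable (Function.uncurry f))
    (hwm : ∀ t, Measurable (w t)) : Measurable (pathDens f w) := by
  refine Measurable.mul (Finset.measurable_fun_prod _ fun t _ => ?_)
    (Finset.measurable_fun_prod _ fun s _ => ?_)
  · exact ((hwm t).comp (measurable_pi_apply t)).ennreal_ofReal
  · exact Measurable.ennreal_ofReal (hfm.comp (g := Function.uncurry f)
      (f := fun z : Fin (n + 1) → Z => (z s.castSucc, z s.succ)) (by fun_prop))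

lemma measurable_predictive (hfm : Measurable (Function.uncurry f))
    (hwm : ∀ t, Measurable (w t)) (s : Fin n) (i : Fin M) :
    Measurable (fun ζ : Fin (n + 1) → Fin M → Z =>
      ∑ j : Fin M, ENNReal.ofReal (w s.castSucc (ζ s.castSucc j))
        * ENNReal.ofReal (f (ζ s.castSucc j) (ζ s.succ i))) :=
  Finset.measurable_fun_sum _ fun j _ =>
    (measurable_weight hwm _ j).mul (measurable_transition hfm _ _ j i)

lemma measurable_weight_sum (hwm : ∀ t, Measurable (w t)) (t : Fin (n + 1)) :
    Measurable (fun ζ : Fin (n + 1) → Fin M → Z =>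
      ∑ j : Fin M, ENNReal.ofReal (w t (ζ t j))) :=
  Finset.measurable_fun_sum _ fun j _ => measurable_weight hwm t j

lemma measurable_resampleDens (hfm : Measurable (Function.uncurry f))
    (hwm : ∀ t, Measurable (w t)) : Measurable (resampleDens (M := M) f w) :=
  Finset.measurable_fun_prod _ fun s _ => Finset.measurable_fun_prod _ fun i _ =>
    (measurable_predictive hfm hwm s i).div (measurable_weight_sum hwm _)

lemma measurable_Chat (hwm : ∀ t, Measurable (w t)) : Measurable (Chat M w) :=
  Finset.measurable_fun_prod _ fun t _ => (measurable_weight_sum hwm t).const_mul _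

lemma measurable_condDens (hfm : Measurable (Function.uncurry f))
    (hwm : ∀ t, Measurable (w t)) (k : Fin (n + 1) → Fin M) :
    Measurable (condDens f w k) := by
  refine Finset.measurable_fun_prod _ fun s _ => Finset.measurable_fun_prod _ fun i _ => ?_
  split_ifs
  · exact measurable_const
  · exact (measurable_predictive hfm hwm s i).div (measurable_weight_sum hwm _)

lemma measurable_bsProb (hfm : Measurable (Function.uncurry f))
    (hwm : ∀ t, Measurable (w t)) (k : Fin (n + 1) → Fin M) :
    Measurable (bsProb f w k) :=
  ((measurable_weight hwm _ _).div (measurable_weight_sum hwm _)).mul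
    (Finset.measurable_fun_prod _ fun s _ =>
      ((measurable_weight hwm _ _).mul (measurable_transition hfm _ _ _ _)).div
        (measurable_predictive hfm hwm s _))

lemma measurable_selectPath (k : Fin (n + 1) → Fin M) :
    Measurable (fun (ζ : Fin (n + 1) → Fin M → Z) t => ζ t (k t)) :=
  measurable_pi_lambda _ fun t => (measurable_pi_apply (k t)).comp (measurable_pi_apply t)

lemma weight_sum_ne_zero (hwpos : ∀ t z, 0 < w t z) (k : Fin M) (t : Fin (n + 1))
    (ζ : Fin (n + 1) → Fin M → Z) : ∑ j : Fin M, ENNReal.ofReal (w t (ζ t j)) ≠ 0 := by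
  intro h
  exact (ENNReal.ofReal_pos.2 (hwpos t (ζ t k))).ne' (Finset.sum_eq_zero_iff.1 h k (by simp))

lemma weight_sum_ne_top (t : Fin (n + 1)) (ζ : Fin (n + 1) → Fin M → Z) :
    ∑ j : Fin M, ENNReal.ofReal (w t (ζ t j)) ≠ ⊤ :=
  ENNReal.sum_ne_top.2 fun _ _ => ENNReal.ofReal_ne_top

lemma predictive_ne_zero (hfpos : ∀ z z', 0 < f z z') (hwpos : ∀ t z, 0 < w t z) (k : Fin M)
    (t : Fin (n + 1)) (z : Z) (ζ : Fin (n + 1) → Fin M → Z) :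
    ∑ j : Fin M, ENNReal.ofReal (w t (ζ t j)) * ENNReal.ofReal (f (ζ t j) z) ≠ 0 := by
  intro h
  exact (ENNReal.mul_pos (ENNReal.ofReal_pos.2 (hwpos t (ζ t k))).ne'
    (ENNReal.ofReal_pos.2 (hfpos (ζ t k) z)).ne').ne' (Finset.sum_eq_zero_iff.1 h k (by simp))

lemma predictive_ne_top (t : Fin (n + 1)) (z : Z) (ζ : Fin (n + 1) → Fin M → Z) :
    ∑ j : Fin M, ENNReal.ofReal (w t (ζ t j)) * ENNReal.ofReal (f (ζ t j) z) ≠ ⊤ :=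
  ENNReal.sum_ne_top.2 fun _ _ => ENNReal.mul_ne_top ENNReal.ofReal_ne_top ENNReal.ofReal_ne_top

lemma bsProb_ne_top (hfpos : ∀ z z', 0 < f z z') (hwpos : ∀ t z, 0 < w t z)
    (k : Fin (n + 1) → Fin M) (ζ : Fin (n + 1) → Fin M → Z) : bsProb f w k ζ ≠ ⊤ :=
  ENNReal.mul_ne_top
    (ENNReal.div_ne_top ENNReal.ofReal_ne_top
      (weight_sum_ne_zero hwpos (k (Fin.last n)) _ ζ))
    (ENNReal.prod_ne_top fun s _ => ENNReal.div_ne_top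
      (ENNReal.mul_ne_top ENNReal.ofReal_ne_top ENNReal.ofReal_ne_top)
      (predictive_ne_zero hfpos hwpos (k s.castSucc) _ _ ζ))

lemma prod_eq_prod_ite_mul {ι α : Type*} [Fintype ι] [DecidableEq ι] [CommMonoid α]
    (x : ι → α) (k : ι) : ∏ i, x i = (∏ i, if i = k then 1 else x i) * x k := by
  rw [← Finset.mul_prod_erase Finset.univ x (Finset.mem_univ k),
    ← Finset.mul_prod_erase Finset.univ (fun i => if i = k then 1 else x i) (Finset.mem_univ k),
    mul_comm]
  simp only [if_true, one_mul]
  congr 1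
  exact Finset.prod_congr rfl fun i hi => (if_neg (Finset.ne_of_mem_erase hi)).symm

/-- The density form of the identity between the extended conditional SMC law and backward
sampling. -/
lemma pathDens_mul_condDens (hfpos : ∀ z z', 0 < f z z') (hwpos : ∀ t z, 0 < w t z)
    (k : Fin (n + 1) → Fin M) (ζ : Fin (n + 1) → Fin M → Z) :
    ((M : ℝ≥0∞) ^ (n + 1))⁻¹ * (pathDens f w (fun t => ζ t (k t)) * condDens f w k ζ)
      = resampleDens f w ζ * Chat M w ζ * bsProb f w k ζ := by
  have hres : resampleDens f w ζ = condDens f w k ζ * ∏ s : Fin n,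
      ((∑ j : Fin M, ENNReal.ofReal (w s.castSucc (ζ s.castSucc j))
        * ENNReal.ofReal (f (ζ s.castSucc j) (ζ s.succ (k s.succ))))
      / ∑ j : Fin M, ENNReal.ofReal (w s.castSucc (ζ s.castSucc j))) := by
    rw [resampleDens, condDens, ← Finset.prod_mul_distrib]
    exact Finset.prod_congr rfl fun s _ => prod_eq_prod_ite_mul _ (k s.succ)
  have hstep : ∀ s : Fin n,
      ((∑ j : Fin M, ENNReal.ofReal (w s.castSucc (ζ s.castSucc j))
        * ENNReal.ofReal (f (ζ s.castSucc j) (ζ s.succ (k s.succ))))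
      / ∑ j : Fin M, ENNReal.ofReal (w s.castSucc (ζ s.castSucc j)))
      * (∑ j : Fin M, ENNReal.ofReal (w s.castSucc (ζ s.castSucc j)))
      * ((ENNReal.ofReal (w s.castSucc (ζ s.castSucc (k s.castSucc)))
          * ENNReal.ofReal (f (ζ s.castSucc (k s.castSucc)) (ζ s.succ (k s.succ))))
        / ∑ i : Fin M, ENNReal.ofReal (w s.castSucc (ζ s.castSucc i))
            * ENNReal.ofReal (f (ζ s.castSucc i) (ζ s.succ (k s.succ))))
      = ENNReal.ofReal (w s.castSucc (ζ s.castSucc (k s.castSucc)))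
          * ENNReal.ofReal (f (ζ s.castSucc (k s.castSucc)) (ζ s.succ (k s.succ))) := fun s => by
    rw [ENNReal.div_mul_cancel (weight_sum_ne_zero hwpos (k 0) _ ζ) (weight_sum_ne_top _ ζ),
      ENNReal.mul_div_cancel (predictive_ne_zero hfpos hwpos (k 0) _ _ ζ)
        (predictive_ne_top _ _ ζ)]
  have hlast : (∑ j : Fin M, ENNReal.ofReal (w (Fin.last n) (ζ (Fin.last n) j)))
      * (ENNReal.ofReal (w (Fin.last n) (ζ (Fin.last n) (k (Fin.last n))))
        / ∑ j : Fin M, ENNReal.ofReal (w (Fin.last n) (ζ (Fin.last n) j)))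
      = ENNReal.ofReal (w (Fin.last n) (ζ (Fin.last n) (k (Fin.last n)))) :=
    ENNReal.mul_div_cancel (weight_sum_ne_zero hwpos (k 0) _ ζ) (weight_sum_ne_top _ ζ)
  have hprod := Finset.prod_congr (rfl : (Finset.univ : Finset (Fin n)) = Finset.univ)
    fun s _ => hstep s
  simp only [Finset.prod_mul_distrib] at hprod
  rw [hres, Chat, bsProb, pathDens, Finset.prod_mul_distrib, Finset.prod_const,
    Finset.card_univ, Fintype.card_fin, ENNReal.inv_pow]
  simp only [Fin.prod_univ_castSucc (n := n)]
  nth_rewrite 1 [← hlast]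
  calc _ = (M : ℝ≥0∞)⁻¹ ^ (n + 1) * condDens f w k ζ *
      ((∑ j : Fin M, ENNReal.ofReal (w (Fin.last n) (ζ (Fin.last n) j))) *
      (ENNReal.ofReal (w (Fin.last n) (ζ (Fin.last n) (k (Fin.last n))))
        / ∑ j : Fin M, ENNReal.ofReal (w (Fin.last n) (ζ (Fin.last n) j)))) *
        ((∏ s : Fin n, ENNReal.ofReal (w s.castSucc (ζ s.castSucc (k s.castSucc)))) *
          ∏ s : Fin n,
            ENNReal.ofReal (f (ζ s.castSucc (k s.castSucc)) (ζ s.succ (k s.succ)))) := by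
        ring
    _ = _ := by
        rw [← hprod]
        ring

end Densities

section Discrete

variable {ι : Type*} [Fintype ι] {X : Type*} [MeasurableSpace X]

lemma isFiniteMeasure_sum_smul_dirac {a : ι → ℝ≥0∞} (ha : ∀ k, a k ≠ ⊤) (x : ι → X) :
    IsFiniteMeasure (∑ k, a k • Measure.dirac (x k)) := by
  refine ⟨?_⟩
  rw [Measure.finsetSum_apply]
  exact ENNReal.sum_lt_top.2 fun k _ => by simpa using (ha k).lt_top

lemma pi_sum_smul_dirac {a : ι → ℝ≥0∞} (ha : ∀ k, a k ≠ ⊤) (x : ι → X) (N : ℕ) :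
    Measure.pi (fun _ : Fin N => ∑ k, a k • Measure.dirac (x k))
      = ∑ K : Fin N → ι, (∏ i, a (K i)) • Measure.dirac (fun i => x (K i)) := by
  have := isFiniteMeasure_sum_smul_dirac ha x
  refine Measure.pi_eq fun s hs => ?_
  simp only [Measure.finsetSum_apply, Measure.smul_apply, smul_eq_mul,
    Measure.dirac_apply' _ (MeasurableSet.univ_pi hs), Measure.dirac_apply' _ (hs _)]
  rw [Fintype.prod_sum]
  refine Finset.sum_congr rfl fun K _ => ?_
  rw [Finset.prod_mul_distrib]
  congr 1
  by_cases h : ∀ i, x (K i) ∈ s i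
  · rw [Set.indicator_of_mem (by simpa using h)]
    simp [Set.indicator_of_mem (h _)]
  · rw [Set.indicator_of_notMem (by simpa using h)]
    obtain ⟨i, hi⟩ := not_forall.1 h
    exact (Finset.prod_eq_zero (Finset.mem_univ i) (Set.indicator_of_notMem hi _)).symm

lemma lintegral_sum_smul_dirac (a : ι → ℝ≥0∞) (x : ι → X) {g : X → ℝ≥0∞}
    (hg : Measurable g) :
    ∫⁻ y, g y ∂(∑ k, a k • Measure.dirac (x k)) = ∑ k, a k * g (x k) := by
  rw [lintegral_finsetSum_measure]
  simp only [lintegral_smul_measure, smul_eq_mul, lintegral_dirac' _ hg]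

end Discrete

lemma measurable_of_measurable_lintegral {X Y : Type*} [MeasurableSpace X] [MeasurableSpace Y]
    {κ : X → Measure Y}
    (hκ : ∀ g : Y → ℝ≥0∞, Measurable g → Measurable (fun x => ∫⁻ y, g y ∂(κ x))) :
    Measurable κ := by
  refine Measure.measurable_of_measurable_coe _ fun s hs => ?_
  simp_rw [← lintegral_indicator_one hs]
  exact hκ _ (measurable_one.indicator hs)


section Kernels

variable {n M : ℕ} {f : Z → Z → ℝ} {w : Fin (n + 1) → Z → ℝ}

lemma map_snd_bsLaw (ζ : Fin (n + 1) → Fin M → Z) :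
    (bsLaw f w ζ).map Prod.snd
      = ∑ k : Fin (n + 1) → Fin M, bsProb f w k ζ • Measure.dirac (fun t => ζ t (k t)) := by
  refine Measure.ext_of_lintegral _ fun g hg => ?_
  have hg' : Measurable fun p : (Fin (n + 1) → Fin M) × (Fin (n + 1) → Z) => g p.2 :=
    hg.comp measurable_snd
  rw [lintegral_map hg measurable_snd, bsLaw, lintegral_sum_smul_dirac _ _ hg',
    lintegral_sum_smul_dirac _ _ hg]

lemma lintegral_map_snd_bsLaw (ζ : Fin (n + 1) → Fin M → Z) {g : (Fin (n + 1) → Z) → ℝ≥0∞}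
    (hg : Measurable g) :
    ∫⁻ z, g z ∂((bsLaw f w ζ).map Prod.snd)
      = ∑ k : Fin (n + 1) → Fin M, bsProb f w k ζ * g (fun t => ζ t (k t)) := by
  rw [map_snd_bsLaw, lintegral_sum_smul_dirac _ _ hg]

lemma isFiniteMeasure_map_snd_bsLaw (hfpos : ∀ z z', 0 < f z z') (hwpos : ∀ t z, 0 < w t z)
    (ζ : Fin (n + 1) → Fin M → Z) : IsFiniteMeasure ((bsLaw f w ζ).map Prod.snd) := by
  rw [map_snd_bsLaw]
  exact isFiniteMeasure_sum_smul_dirac (fun k => bsProb_ne_top hfpos hwpos k ζ) _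

lemma measurable_lintegral_bsLaw (hfm : Measurable (Function.uncurry f))
    (hwm : ∀ t, Measurable (w t))
    {h : (Fin (n + 1) → Fin M → Z) × (Fin (n + 1) → Z) → ℝ≥0∞} (hh : Measurable h) :
    Measurable (fun ζ : Fin (n + 1) → Fin M → Z =>
      ∫⁻ z, h (ζ, z) ∂((bsLaw f w ζ).map Prod.snd)) := by
  have hs : ∀ ζ, ∫⁻ z, h (ζ, z) ∂((bsLaw f w ζ).map Prod.snd)
      = ∑ k : Fin (n + 1) → Fin M, bsProb f w k ζ * h (ζ, fun t => ζ t (k t)) := fun ζ =>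
    lintegral_map_snd_bsLaw ζ (hh.comp measurable_prodMk_left)
  simp_rw [hs]
  exact Finset.measurable_fun_sum _ fun k _ => (measurable_bsProb hfm hwm k).mul
    (hh.comp (measurable_id.prodMk (measurable_selectPath k)))

lemma measurable_lintegral_pi_bsLaw {X : Type*} [MeasurableSpace X]
    (hfm : Measurable (Function.uncurry f)) (hfpos : ∀ z z', 0 < f z z')
    (hwm : ∀ t, Measurable (w t)) (hwpos : ∀ t z, 0 < w t z) (N : ℕ)
    {e : X → Fin (n + 1) → Fin M → Z} (he : Measurable e)
    {h : X × (Fin N → Fin (n + 1) → Z) → ℝ≥0∞} (hh : Measurable h) :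
    Measurable (fun x =>
      ∫⁻ us, h (x, us) ∂(Measure.pi (fun _ : Fin N => (bsLaw f w (e x)).map Prod.snd))) := by
  have hs : ∀ x,
      ∫⁻ us, h (x, us) ∂(Measure.pi (fun _ : Fin N => (bsLaw f w (e x)).map Prod.snd))
      = ∑ K : Fin N → Fin (n + 1) → Fin M, (∏ i, bsProb f w (K i) (e x))
        * h (x, fun i t => e x t (K i t)) := fun x => by
    have hx : Measurable fun us => h (x, us) := hh.comp measurable_prodMk_left
    rw [map_snd_bsLaw, pi_sum_smul_dirac (fun k => bsProb_ne_top hfpos hwpos k (e x)),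
      lintegral_sum_smul_dirac _ _ hx]
  simp_rw [hs]
  exact Finset.measurable_fun_sum _ fun K _ =>
    (Finset.measurable_fun_prod _ fun i _ => (measurable_bsProb hfm hwm (K i)).comp he).mul
      (hh.comp (measurable_id.prodMk
        (measurable_pi_lambda _ fun i => (measurable_selectPath (K i)).comp he)))

lemma condBase_eq_map (lam μ : Measure Z) [SigmaFinite lam] [SigmaFinite μ] {m : ℕ}
    (z : Fin (n + 1) → Z) (k : Fin (n + 1) → Fin (m + 1)) :
    condBase lam μ z k = (particleBase lam μ n m).map (insertPath k z) := by
  have : ∀ t : Fin (n + 1), SigmaFinite (if t = 0 then μ else lam) := fun t =>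
    sigmaFinite_ite _ _ _
  exact pi_pi_ite_dirac (fun t : Fin (n + 1) => if t = 0 then μ else lam) k z

lemma sigmaFinite_particleBase (lam μ : Measure Z) [SigmaFinite lam] [SigmaFinite μ] (n M : ℕ) :
    SigmaFinite (particleBase lam μ n M) := by
  have : ∀ t : Fin (n + 1), SigmaFinite (if t = 0 then μ else lam) := fun t =>
    sigmaFinite_ite _ _ _
  unfold particleBase
  infer_instance

/-- Refreshing the path `z` together with the conditional base measure gives back the base measure
on particles, with `z` sitting at the slots `k`. -/
lemma lintegral_pathBase_condBase (lam μ : Measure Z) [SigmaFinite lam] [SigmaFinite μ] {m : ℕ}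
    (k : Fin (n + 1) → Fin (m + 1))
    {h : (Fin (n + 1) → Z) × (Fin (n + 1) → Fin (m + 1) → Z) → ℝ≥0∞} (hh : Measurable h) :
    ∫⁻ z, ∫⁻ ζ, h (z, ζ) ∂(condBase lam μ z k) ∂(pathBase lam μ n)
      = ∫⁻ ζ, h (fun t => ζ t (k t), ζ) ∂(particleBase lam μ n (m + 1)) := by
  have : ∀ t : Fin (n + 1), SigmaFinite (if t = 0 then μ else lam) := fun t =>
    sigmaFinite_ite _ _ _
  have := sigmaFinite_particleBase lam μ n m
  have hins : ∀ z : Fin (n + 1) → Z, Measurable (insertPath (m := m) k z) := fun z =>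
    (measurable_insertPath k).comp measurable_prodMk_left
  have hmp := measurePreserving_insertPath
    (fun t : Fin (n + 1) => if t = 0 then μ else lam) k
  have hg : Measurable (fun ζ : Fin (n + 1) → Fin (m + 1) → Z =>
      h (fun t => ζ t (k t), ζ)) := hh.comp ((measurable_selectPath k).prodMk measurable_id)
  have hgi : Measurable (fun p : (Fin (n + 1) → Z) × (Fin (n + 1) → Fin m → Z) =>
      h (fun t => insertPath k p.1 p.2 t (k t), insertPath k p.1 p.2)) :=
    hg.comp (measurable_insertPath k)
  rw [particleBase, ← hmp.lintegral_comp hg, lintegral_prod _ hgi.aemeasurable]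
  refine lintegral_congr fun z => ?_
  have hz : Measurable fun ζ => h (z, ζ) := hh.comp measurable_prodMk_left
  rw [condBase_eq_map, lintegral_map hz (hins z)]
  simp only [insertPath_apply_slot]
  rfl

lemma lintegral_map_snd_csmcLaw (lam μ : Measure Z) (hfm : Measurable (Function.uncurry f))
    (hwm : ∀ t, Measurable (w t)) (z : Fin (n + 1) → Z)
    {g : (Fin (n + 1) → Fin M → Z) → ℝ≥0∞} (hg : Measurable g) :
    ∫⁻ ζ, g ζ ∂((csmcLaw lam μ M f w z).map Prod.snd)
      = ∑ k : Fin (n + 1) → Fin M, ((M : ℝ≥0∞) ^ (n + 1))⁻¹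
        * ∫⁻ ζ, condDens f w k ζ * g ζ ∂(condBase lam μ z k) := by
  rw [lintegral_map hg measurable_snd, csmcLaw, lintegral_finsetSum_measure]
  refine Finset.sum_congr rfl fun k _ => ?_
  have hg' : Measurable fun p : (Fin (n + 1) → Fin M) × (Fin (n + 1) → Fin M → Z) => g p.2 :=
    hg.comp measurable_snd
  rw [lintegral_smul_measure, lintegral_map hg' measurable_prodMk_left,
    lintegral_withDensity_eq_lintegral_mul _ (measurable_condDens hfm hwm k) hg]
  rfl

lemma measurable_lintegral_condBase (lam μ : Measure Z) [SigmaFinite lam] [SigmaFinite μ] {m : ℕ}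
    (k : Fin (n + 1) → Fin (m + 1))
    {h : (Fin (n + 1) → Z) × (Fin (n + 1) → Fin (m + 1) → Z) → ℝ≥0∞} (hh : Measurable h) :
    Measurable (fun z => ∫⁻ ζ, h (z, ζ) ∂(condBase lam μ z k)) := by
  have := sigmaFinite_particleBase lam μ n m
  have hins : ∀ z : Fin (n + 1) → Z, Measurable (insertPath (m := m) k z) := fun z =>
    (measurable_insertPath k).comp measurable_prodMk_left
  have hs : ∀ z, ∫⁻ ζ, h (z, ζ) ∂(condBase lam μ z k)
      = ∫⁻ η, h (z, insertPath k z η) ∂(particleBase lam μ n m) := fun z => by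
    have hz : Measurable fun ζ => h (z, ζ) := hh.comp measurable_prodMk_left
    rw [condBase_eq_map, lintegral_map hz (hins z)]
  simp_rw [hs]
  exact Measurable.lintegral_prod_right'
    (f := fun p : (Fin (n + 1) → Z) × (Fin (n + 1) → Fin m → Z) => h (p.1, insertPath k p.1 p.2))
    (hh.comp (measurable_fst.prodMk (measurable_insertPath k)))

lemma measurable_lintegral_csmcLaw (lam μ : Measure Z) [SigmaFinite lam] [SigmaFinite μ]
    (hM : 1 ≤ M) (hfm : Measurable (Function.uncurry f)) (hwm : ∀ t, Measurable (w t))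
    {h : (Fin (n + 1) → Z) × (Fin (n + 1) → Fin M → Z) → ℝ≥0∞} (hh : Measurable h) :
    Measurable (fun z => ∫⁻ ζ, h (z, ζ) ∂((csmcLaw lam μ M f w z).map Prod.snd)) := by
  obtain ⟨m, rfl⟩ := Nat.exists_eq_add_of_le' hM
  have hs := fun z => lintegral_map_snd_csmcLaw lam μ hfm hwm z
    (hh.comp (measurable_prodMk_left (x := z)))
  simp only [Function.comp_apply] at hs
  simp_rw [hs]
  exact Finset.measurable_fun_sum _ fun k _ => (measurable_lintegral_condBase lam μ k
    (h := fun p => condDens f w k p.2 * h p)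
    (((measurable_condDens hfm hwm k).comp measurable_snd).mul hh)).const_mul _

/-- The reference path together with its conditional SMC particles has the same law as the
particles under `smcBar` together with one backward-sampled path. -/
lemma lintegral_targetLaw_csmcLaw (lam μ : Measure Z) [SigmaFinite lam] [SigmaFinite μ]
    (hM : 1 ≤ M) (hfm : Measurable (Function.uncurry f)) (hfpos : ∀ z z', 0 < f z z')
    (hwm : ∀ t, Measurable (w t)) (hwpos : ∀ t z, 0 < w t z) (C : ℝ≥0∞)
    {h : (Fin (n + 1) → Z) × (Fin (n + 1) → Fin M → Z) → ℝ≥0∞} (hh : Measurable h) :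
    ∫⁻ z, ∫⁻ ζ, h (z, ζ) ∂((csmcLaw lam μ M f w z).map Prod.snd) ∂(targetLaw lam μ f w C)
      = ∫⁻ ζ, ∫⁻ z, h (z, ζ) ∂((bsLaw f w ζ).map Prod.snd) ∂(smcBar lam μ M f w C) := by
  obtain ⟨m, rfl⟩ := Nat.exists_eq_add_of_le' hM
  have hcond := fun k : Fin (n + 1) → Fin (m + 1) => measurable_condDens hfm hwm k
  have hpath := (measurable_pathDens hfm hwm).const_mul C⁻¹
  have hres := measurable_resampleDens (M := m + 1) hfm hwm
  have hchat := (measurable_Chat (M := m + 1) hwm).div_const C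
  have hbs := fun k : Fin (n + 1) → Fin (m + 1) => measurable_bsProb hfm hwm k
  have hsel : ∀ k : Fin (n + 1) → Fin (m + 1),
      Measurable (fun ζ : Fin (n + 1) → Fin (m + 1) → Z => h (fun t => ζ t (k t), ζ)) :=
    fun k => hh.comp ((measurable_selectPath k).prodMk measurable_id)
  have hprod : ∀ k : Fin (n + 1) → Fin (m + 1), Measurable
      (fun p : (Fin (n + 1) → Z) × (Fin (n + 1) → Fin (m + 1) → Z) =>
        condDens f w k p.2 * h p) := fun k => ((hcond k).comp measurable_snd).mul hh
  have hL : ∀ z, ∫⁻ ζ, h (z, ζ) ∂((csmcLaw lam μ (m + 1) f w z).map Prod.snd)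
      = ∑ k : Fin (n + 1) → Fin (m + 1), (((m + 1 : ℕ) : ℝ≥0∞) ^ (n + 1))⁻¹
        * ∫⁻ ζ, condDens f w k ζ * h (z, ζ) ∂(condBase lam μ z k) := fun z =>
    lintegral_map_snd_csmcLaw lam μ hfm hwm z (hh.comp measurable_prodMk_left)
  have hR : ∀ ζ, ∫⁻ z, h (z, ζ) ∂((bsLaw f w ζ).map Prod.snd)
      = ∑ k : Fin (n + 1) → Fin (m + 1), bsProb f w k ζ * h (fun t => ζ t (k t), ζ) :=
    fun ζ => lintegral_map_snd_bsLaw ζ (hh.comp measurable_prodMk_right)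
  simp_rw [hL, hR]
  have hLm : ∀ k : Fin (n + 1) → Fin (m + 1), Measurable fun z =>
      (((m + 1 : ℕ) : ℝ≥0∞) ^ (n + 1))⁻¹
        * ∫⁻ ζ, condDens f w k ζ * h (z, ζ) ∂(condBase lam μ z k) := fun k =>
    (measurable_lintegral_condBase lam μ k (hprod k)).const_mul _
  have hRm : ∀ k : Fin (n + 1) → Fin (m + 1), Measurable
      fun ζ : Fin (n + 1) → Fin (m + 1) → Z =>
        bsProb f w k ζ * h (fun t => ζ t (k t), ζ) := fun k => (hbs k).mul (hsel k)
  rw [lintegral_finsetSum _ fun k _ => hLm k, lintegral_finsetSum _ fun k _ => hRm k]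
  refine Finset.sum_congr rfl fun k _ => ?_
  have hbar : ∀ g : (Fin (n + 1) → Fin (m + 1) → Z) → ℝ≥0∞, Measurable g →
      ∫⁻ ζ, g ζ ∂(smcBar lam μ (m + 1) f w C) = ∫⁻ ζ, resampleDens f w ζ *
        (Chat (m + 1) w ζ / C * g ζ) ∂(particleBase lam μ n (m + 1)) := fun g hg => by
    rw [smcBar, lintegral_withDensity_eq_lintegral_mul _ hchat hg, smcLaw,
      lintegral_withDensity_eq_lintegral_mul _ hres (hchat.mul hg)]
    rfl
  rw [targetLaw, lintegral_withDensity_eq_lintegral_mul _ hpath (hLm k), hbar _ (hRm k)]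
  have key := lintegral_pathBase_condBase lam μ k
    (h := fun p => C⁻¹ * pathDens f w p.1 * ((((m + 1 : ℕ) : ℝ≥0∞) ^ (n + 1))⁻¹ *
      (condDens f w k p.2 * h p)))
    ((hpath.comp measurable_fst).mul ((hprod k).const_mul _))
  refine Eq.trans (lintegral_congr fun z => ?_) (key.trans (lintegral_congr fun ζ => ?_))
  · have hz : Measurable fun ζ => condDens f w k ζ * h (z, ζ) :=
      (hcond k).mul (hh.comp measurable_prodMk_left)
    change _ = ∫⁻ ζ, C⁻¹ * pathDens f w z * ((((m + 1 : ℕ) : ℝ≥0∞) ^ (n + 1))⁻¹ *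
      (condDens f w k ζ * h (z, ζ))) ∂(condBase lam μ z k)
    rw [lintegral_const_mul _ (hz.const_mul _), lintegral_const_mul _ hz]
    rfl
  · have hid := pathDens_mul_condDens (M := m + 1) hfpos hwpos k ζ
    change C⁻¹ * pathDens f w (fun t => ζ t (k t)) * ((((m + 1 : ℕ) : ℝ≥0∞) ^ (n + 1))⁻¹ *
        (condDens f w k ζ * h (fun t => ζ t (k t), ζ)))
      = resampleDens f w ζ * (Chat (m + 1) w ζ / C *
        (bsProb f w k ζ * h (fun t => ζ t (k t), ζ)))
    generalize pathDens f w (fun t => ζ t (k t)) = a at *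
    generalize condDens f w k ζ = b at *
    generalize resampleDens f w ζ = c at *
    generalize Chat (m + 1) w ζ = d at *
    generalize bsProb f w k ζ = e at *
    generalize h (fun t => ζ t (k t), ζ) = u at *
    generalize (((m + 1 : ℕ) : ℝ≥0∞) ^ (n + 1))⁻¹ = v at *
    calc _ = C⁻¹ * (v * (a * b)) * u := by ring
      _ = _ := by rw [hid, div_eq_mul_inv]; ring

end Kernels

section Joint

variable {n M : ℕ} {f : Z → Z → ℝ} {w : Fin (n + 1) → Z → ℝ} {N : ℕ} {W : Type*}
  [MeasurableSpace W]
  {e : (Fin (n + 1) → Z) → (Fin (n + 1) → Fin M → Z) → (Fin N → Fin (n + 1) → Z) → W}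

lemma measurable_map_pi_bsLaw (hfm : Measurable (Function.uncurry f))
    (hfpos : ∀ z z', 0 < f z z') (hwm : ∀ t, Measurable (w t)) (hwpos : ∀ t z, 0 < w t z)
    (he : Measurable fun p : ((Fin (n + 1) → Z) × (Fin (n + 1) → Fin M → Z)) ×
      (Fin N → Fin (n + 1) → Z) => e p.1.1 p.1.2 p.2) :
    Measurable fun p : (Fin (n + 1) → Z) × (Fin (n + 1) → Fin M → Z) =>
      (Measure.pi (fun _ : Fin N => (bsLaw f w p.2).map Prod.snd)).map (e p.1 p.2) := by
  refine measurable_of_measurable_lintegral fun g hg => ?_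
  have hs : ∀ p : (Fin (n + 1) → Z) × (Fin (n + 1) → Fin M → Z),
      ∫⁻ x, g x ∂((Measure.pi (fun _ : Fin N => (bsLaw f w p.2).map Prod.snd)).map (e p.1 p.2))
      = ∫⁻ us, g (e p.1 p.2 us) ∂(Measure.pi (fun _ : Fin N => (bsLaw f w p.2).map Prod.snd)) :=
    fun p => lintegral_map hg (he.comp (measurable_prodMk_left (x := p)))
  simp_rw [hs]
  exact measurable_lintegral_pi_bsLaw hfm hfpos hwm hwpos N measurable_snd (hg.comp he)

lemma lintegral_bind_csmcLaw (lam μ : Measure Z) [SigmaFinite lam] [SigmaFinite μ]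
    (hM : 1 ≤ M) (hfm : Measurable (Function.uncurry f)) (hfpos : ∀ z z', 0 < f z z')
    (hwm : ∀ t, Measurable (w t)) (hwpos : ∀ t z, 0 < w t z) (C : ℝ≥0∞)
    (he : Measurable fun p : ((Fin (n + 1) → Z) × (Fin (n + 1) → Fin M → Z)) ×
      (Fin N → Fin (n + 1) → Z) => e p.1.1 p.1.2 p.2)
    {g : W → ℝ≥0∞} (hg : Measurable g) :
    ∫⁻ x, g x ∂((targetLaw lam μ f w C).bind fun z =>
        ((csmcLaw lam μ M f w z).map Prod.snd).bind fun ζ =>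
          (Measure.pi (fun _ : Fin N => (bsLaw f w ζ).map Prod.snd)).map (e z ζ))
      = ∫⁻ ζ, ∫⁻ z, ∫⁻ us, g (e z ζ us)
          ∂(Measure.pi (fun _ : Fin N => (bsLaw f w ζ).map Prod.snd))
          ∂((bsLaw f w ζ).map Prod.snd) ∂(smcBar lam μ M f w C) := by
  have hκ := measurable_map_pi_bsLaw hfm hfpos hwm hwpos he
  have hκz : ∀ z, Measurable fun ζ : Fin (n + 1) → Fin M → Z =>
      (Measure.pi (fun _ : Fin N => (bsLaw f w ζ).map Prod.snd)).map (e z ζ) := fun z =>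
    hκ.comp measurable_prodMk_left
  have hin : ∀ g : W → ℝ≥0∞, Measurable g → ∀ z,
      ∫⁻ x, g x ∂(((csmcLaw lam μ M f w z).map Prod.snd).bind fun ζ =>
          (Measure.pi (fun _ : Fin N => (bsLaw f w ζ).map Prod.snd)).map (e z ζ))
      = ∫⁻ ζ, ∫⁻ us, g (e z ζ us) ∂(Measure.pi (fun _ : Fin N => (bsLaw f w ζ).map Prod.snd))
          ∂((csmcLaw lam μ M f w z).map Prod.snd) := fun g hg z => by
    rw [Measure.lintegral_bind (hκz z).aemeasurable hg.aemeasurable]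
    exact lintegral_congr fun ζ =>
      lintegral_map hg (he.comp (measurable_prodMk_left (x := (z, ζ))))
  have hmeas : ∀ g : W → ℝ≥0∞, Measurable g →
      Measurable fun p : (Fin (n + 1) → Z) × (Fin (n + 1) → Fin M → Z) =>
        ∫⁻ us, g (e p.1 p.2 us) ∂(Measure.pi (fun _ : Fin N => (bsLaw f w p.2).map Prod.snd)) :=
    fun g hg => measurable_lintegral_pi_bsLaw hfm hfpos hwm hwpos N measurable_snd (hg.comp he)
  have hbind : Measurable fun z => ((csmcLaw lam μ M f w z).map Prod.snd).bind fun ζ =>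
      (Measure.pi (fun _ : Fin N => (bsLaw f w ζ).map Prod.snd)).map (e z ζ) := by
    refine measurable_of_measurable_lintegral fun g hg => ?_
    simp_rw [hin g hg]
    exact measurable_lintegral_csmcLaw lam μ hM hfm hwm (hmeas g hg)
  rw [Measure.lintegral_bind hbind.aemeasurable hg.aemeasurable]
  simp_rw [hin g hg]
  exact lintegral_targetLaw_csmcLaw lam μ hM hfm hfpos hwm hwpos C (hmeas g hg)

lemma lintegral_bind_smcBar (lam μ : Measure Z) (hfm : Measurable (Function.uncurry f))
    (hfpos : ∀ z z', 0 < f z z') (hwm : ∀ t, Measurable (w t)) (hwpos : ∀ t z, 0 < w t z)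
    (C : ℝ≥0∞)
    (he : Measurable fun p : ((Fin (n + 1) → Z) × (Fin (n + 1) → Fin M → Z)) ×
      (Fin N → Fin (n + 1) → Z) => e p.1.1 p.1.2 p.2)
    {g : W → ℝ≥0∞} (hg : Measurable g) :
    ∫⁻ x, g x ∂((smcBar lam μ M f w C).bind fun ζ =>
        ((bsLaw f w ζ).map Prod.snd).bind fun z =>
          (Measure.pi (fun _ : Fin N => (bsLaw f w ζ).map Prod.snd)).map (e z ζ))
      = ∫⁻ ζ, ∫⁻ z, ∫⁻ us, g (e z ζ us)
          ∂(Measure.pi (fun _ : Fin N => (bsLaw f w ζ).map Prod.snd))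
          ∂((bsLaw f w ζ).map Prod.snd) ∂(smcBar lam μ M f w C) := by
  have hκ := measurable_map_pi_bsLaw hfm hfpos hwm hwpos he
  have hκζ : ∀ ζ : Fin (n + 1) → Fin M → Z, Measurable fun z =>
      (Measure.pi (fun _ : Fin N => (bsLaw f w ζ).map Prod.snd)).map (e z ζ) := fun ζ =>
    hκ.comp measurable_prodMk_right
  have hin : ∀ g : W → ℝ≥0∞, Measurable g → ∀ ζ,
      ∫⁻ x, g x ∂(((bsLaw f w ζ).map Prod.snd).bind fun z =>
          (Measure.pi (fun _ : Fin N => (bsLaw f w ζ).map Prod.snd)).map (e z ζ))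
      = ∫⁻ z, ∫⁻ us, g (e z ζ us) ∂(Measure.pi (fun _ : Fin N => (bsLaw f w ζ).map Prod.snd))
          ∂((bsLaw f w ζ).map Prod.snd) := fun g hg ζ => by
    rw [Measure.lintegral_bind (hκζ ζ).aemeasurable hg.aemeasurable]
    exact lintegral_congr fun z =>
      lintegral_map hg (he.comp (measurable_prodMk_left (x := (z, ζ))))
  have hbind : Measurable fun ζ : Fin (n + 1) → Fin M → Z =>
      ((bsLaw f w ζ).map Prod.snd).bind fun z =>
        (Measure.pi (fun _ : Fin N => (bsLaw f w ζ).map Prod.snd)).map (e z ζ) := by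
    refine measurable_of_measurable_lintegral fun g hg => ?_
    simp_rw [hin g hg]
    have hmeas := measurable_lintegral_pi_bsLaw hfm hfpos hwm hwpos N measurable_snd (hg.comp he)
    exact measurable_lintegral_bsLaw hfm hwm (hmeas.comp measurable_swap)
  rw [Measure.lintegral_bind hbind.aemeasurable hg.aemeasurable]
  simp_rw [hin g hg]

end Joint

lemma measurable_cons {X : Type*} [MeasurableSpace X] {N : ℕ} :
    Measurable fun p : X × (Fin N → X) => (Fin.cons p.1 p.2 : Fin (N + 1) → X) := by
  simpa only [Fin.insertNth_zero'] using measurable_insertNth_prod (Z := X) (0 : Fin (N + 1))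

lemma lintegral_lintegral_pi_cons {X : Type*} [MeasurableSpace X] (ν : Measure X)
    [SigmaFinite ν] (N : ℕ) {g : (Fin (N + 1) → X) → ℝ≥0∞} (hg : Measurable g) :
    ∫⁻ x, ∫⁻ us, g (Fin.cons x us) ∂(Measure.pi fun _ : Fin N => ν) ∂ν
      = ∫⁻ v, g v ∂(Measure.pi fun _ : Fin (N + 1) => ν) := by
  have hmp := measurePreserving_insertNth (fun _ : Fin (N + 1) => ν) 0
  simp only [Fin.insertNth_zero'] at hmp
  have hgc : Measurable fun p : X × (Fin N → X) =>
      g (Fin.cons p.1 p.2 : Fin (N + 1) → X) := hg.comp measurable_cons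
  rw [← hmp.lintegral_comp hg, lintegral_prod _ hgc.aemeasurable]

lemma measurePreserving_comp_perm {ι X : Type*} [Fintype ι] [MeasurableSpace X] (ν : Measure X)
    [SigmaFinite ν] (σ : Equiv.Perm ι) :
    MeasurePreserving (fun v : ι → X => v ∘ σ) (Measure.pi fun _ => ν)
      (Measure.pi fun _ => ν) := by
  have hm : Measurable (fun v : ι → X => v ∘ σ) :=
    measurable_pi_lambda _ fun i => measurable_pi_apply (σ i)
  refine ⟨hm, (Measure.pi_eq fun s hs => ?_).symm⟩
  have hpre : (fun v : ι → X => v ∘ σ) ⁻¹' Set.univ.pi s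
      = Set.univ.pi fun i => s (σ.symm i) := by
    ext v
    simp only [Set.mem_preimage, Set.mem_univ_pi, Function.comp_apply]
    exact ⟨fun h i => by simpa using h (σ.symm i), fun h i => by simpa using h (σ i)⟩
  rw [Measure.map_apply hm (MeasurableSet.univ_pi hs), hpre, Measure.pi_pi]
  exact Equiv.prod_comp σ.symm fun i => ν (s i)

/-- **Exchangeability of the reference path and backward-sampled paths (Corollary
`cor:exchangeability-SSM` of Andrieu, Doucet, Yıldırım & Chopin):** for every `N ≥ 1`, as
measures on `Z^T × Z^{MT} × (Z^T)^N`,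
`π(dz) Φ(z, dζ) ∏ᵢ Φ̌(ζ, du⁽ⁱ⁾) = ψ̄(dζ) Φ̌(ζ, dz) ∏ᵢ Φ̌(ζ, du⁽ⁱ⁾)`, and consequently
under the joint law `π(dz) ∫ Φ(z, dζ) ∏ᵢ Φ̌(ζ, du⁽ⁱ⁾)` the variables
`z, u⁽¹⁾, …, u⁽ᴺ⁾` are exchangeable. -/
theorem csmc_exchangeability
    (lam : Measure Z) [SigmaFinite lam] (μ : Measure Z) [IsProbabilityMeasure μ]
    (n M : ℕ) (hM : 1 ≤ M)
    (f : Z → Z → ℝ) (hfm : Measurable (Function.uncurry f))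
    (hfpos : ∀ z z', 0 < f z z')
    (hfMarkov : ∀ z, ∫⁻ z', ENNReal.ofReal (f z z') ∂lam = 1)
    (w : Fin (n + 1) → Z → ℝ) (hwm : ∀ t, Measurable (w t))
    (hwpos : ∀ t z, 0 < w t z)
    (C : ℝ≥0∞) (hC : C = ∫⁻ z, pathDens f w z ∂(pathBase lam μ n))
    (hCpos : 0 < C) (hCfin : C ≠ ⊤)
    (N : ℕ) (hN : 1 ≤ N) :
    -- (i) the joint-law identity
    ((targetLaw lam μ f w C).bind (fun z =>
        ((csmcLaw lam μ M f w z).map Prod.snd).bind (fun ζ =>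
          (Measure.pi (fun _ : Fin N => (bsLaw f w ζ).map Prod.snd)).map
            (fun us => (z, ζ, us))))
      = (smcBar lam μ M f w C).bind (fun ζ =>
          ((bsLaw f w ζ).map Prod.snd).bind (fun z =>
            (Measure.pi (fun _ : Fin N => (bsLaw f w ζ).map Prod.snd)).map
              (fun us => (z, ζ, us)))))
    -- (ii) exchangeability of `z, u⁽¹⁾, …, u⁽ᴺ⁾`
    ∧ (∀ σ : Equiv.Perm (Fin (N + 1)),
        ((targetLaw lam μ f w C).bind (fun z =>
            ((csmcLaw lam μ M f w z).map Prod.snd).bind (fun ζ =>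
              (Measure.pi (fun _ : Fin N => (bsLaw f w ζ).map Prod.snd)).map
                (fun us => Fin.cons z us)))).map (fun v => v ∘ σ)
          = (targetLaw lam μ f w C).bind (fun z =>
              ((csmcLaw lam μ M f w z).map Prod.snd).bind (fun ζ =>
                (Measure.pi (fun _ : Fin N => (bsLaw f w ζ).map Prod.snd)).map
                  (fun us => Fin.cons z us)))) := by
  refine ⟨Measure.ext_of_lintegral _ fun g hg => ?_, fun σ =>
    Measure.ext_of_lintegral _ fun g hg => ?_⟩
  · have he : Measurable fun p : ((Fin (n + 1) → Z) × (Fin (n + 1) → Fin M → Z)) ×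
        (Fin N → Fin (n + 1) → Z) => (p.1.1, p.1.2, p.2) := by fun_prop
    exact (lintegral_bind_csmcLaw (e := fun z ζ us => (z, ζ, us)) lam μ hM hfm hfpos hwm hwpos C
      he hg).trans (lintegral_bind_smcBar (e := fun z ζ us => (z, ζ, us)) lam μ hfm hfpos hwm
      hwpos C he hg).symm
  · have he : Measurable fun p : ((Fin (n + 1) → Z) × (Fin (n + 1) → Fin M → Z)) ×
        (Fin N → Fin (n + 1) → Z) => (Fin.cons p.1.1 p.2 : Fin (N + 1) → Fin (n + 1) → Z) :=
      measurable_cons.comp ((measurable_fst.comp measurable_fst).prodMk measurable_snd)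
    have hσ : Measurable fun v : Fin (N + 1) → Fin (n + 1) → Z => v ∘ σ :=
      measurable_pi_lambda _ fun i => measurable_pi_apply (σ i)
    have hgσ : Measurable fun v : Fin (N + 1) → Fin (n + 1) → Z => g (v ∘ σ) := hg.comp hσ
    have hlaw : ∀ g : (Fin (N + 1) → Fin (n + 1) → Z) → ℝ≥0∞, Measurable g → _ := fun g hg =>
      lintegral_bind_csmcLaw (e := fun z _ us => (Fin.cons z us : Fin (N + 1) → Fin (n + 1) → Z))
        lam μ hM hfm hfpos hwm hwpos C he hg
    rw [lintegral_map hg hσ, hlaw _ hgσ, hlaw _ hg]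
    refine lintegral_congr fun ζ => ?_
    have := isFiniteMeasure_map_snd_bsLaw hfpos hwpos ζ
    rw [lintegral_lintegral_pi_cons _ N hgσ, lintegral_lintegral_pi_cons _ N hg]
    exact (measurePreserving_comp_perm _ σ).lintegral_comp hg

end CSMC
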